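/- Let λ > 1, m ∈ (0,1], δ ∈ (0,1), and ε > 0. If the amplification factor e(ε) = [(2m−1)(λε+1) + √((λε+1)² + 4m(1−m)(λ−1)²ε) − 2mλ(ε+1)] / [(2m−1)(λε+1) + √((λε+1)² + 4m(1−m)(λ−1)²ε) − 2m(ε+1)] satisfies e(ε)² > δ, then m > (1+√δ)(λ√δ·ε − 1) / ((1 + δε)(λ − 1)). -/

import Mathlib

/-- If `e(ε)² > δ` then `m > (1+√δ)(λ√δ ε − 1)/((1+δε)(λ−1))`. -/
theorem stmt_18 (lam m δ ε : ℝ) (hlam : 1 < lam) (hm0 : 0 < m) (hm1 : m ≤ 1)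
    (hδ0 : 0 < δ) (hδ1 : δ < 1) (hε : 0 < ε)
    (he : δ <
      (((2*m - 1)*(lam*ε + 1) +
          Real.sqrt ((lam*ε + 1)^2 + 4*m*(1 - m)*(lam - 1)^2*ε) - 2*m*lam*(ε + 1)) /
        ((2*m - 1)*(lam*ε + 1) +
          Real.sqrt ((lam*ε + 1)^2 + 4*m*(1 - m)*(lam - 1)^2*ε) - 2*m*(ε + 1)))^2) :
    (1 + Real.sqrt δ) * (lam * Real.sqrt δ * ε - 1) / ((1 + δ*ε) * (lam - 1)) < m := by
  obtain ⟨s, hs⟩ : ∃ s, s = Real.sqrt δ := ⟨_, rfl⟩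
  obtain ⟨S, hS⟩ : ∃ S, S = Real.sqrt ((lam*ε + 1)^2 + 4*m*(1 - m)*(lam - 1)^2*ε) := ⟨_, rfl⟩
  rw [← hS] at he
  rw [← hs]
  have hs0 : 0 < s := hs ▸ Real.sqrt_pos.mpr hδ0
  have hsδ : δ = s ^ 2 := by rw [hs, Real.sq_sqrt hδ0.le]
  have hc : 0 < lam - 1 := sub_pos.mpr hlam
  have hm : 0 ≤ 1 - m := sub_nonneg.mpr hm1
  have hA : 0 < lam * ε + 1 := by positivity
  have hrad : 0 ≤ 4*m*(1 - m)*(lam - 1)^2*ε := by positivity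
  have hSsq : S ^ 2 = (lam*ε + 1)^2 + 4*m*(1 - m)*(lam - 1)^2*ε := by
    rw [hS, Real.sq_sqrt (by positivity)]
  have hAS : lam * ε + 1 ≤ S := hS ▸ Real.le_sqrt_of_sq_le (by linarith)
  have hmc : 0 < m * (lam - 1) := mul_pos hm0 hc
  have hSlt : S < lam * ε + 1 + 2 * (m * (lam - 1)) := by
    refine lt_of_pow_lt_pow_left₀ 2 (by positivity) ?_
    have h1 : (1 - m) * ((lam - 1) * ε) ≤ (lam - 1) * ε :=
      mul_le_of_le_one_left (by positivity) (by linarith)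
    have h2 : (1 - m) * ((lam - 1) * ε) < lam * ε + 1 := by linarith
    have h3 := mul_lt_mul_of_pos_left h2 hmc
    rw [hSsq]
    nlinarith [sq_nonneg (m * (lam - 1))]
  have hmcε : 0 < m * (lam - 1) * ε := mul_pos hmc hε
  have hD : 0 < S - (lam * ε + 1) + 2 * (m * (lam - 1) * ε) := by linarith
  have hN : (2*m - 1)*(lam*ε + 1) + S - 2*m*lam*(ε + 1)
      = -(lam * ε + 1 + 2 * (m * (lam - 1)) - S) := by ring
  have hDeq : (2*m - 1)*(lam*ε + 1) + S - 2*m*(ε + 1)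
      = S - (lam * ε + 1) + 2 * (m * (lam - 1) * ε) := by ring
  rw [hN, hDeq, neg_div, neg_sq, hsδ] at he
  have hratio := lt_of_pow_lt_pow_left₀ 2 (div_pos (sub_pos.mpr hSlt) hD).le he
  rw [lt_div_iff₀ hD] at hratio
  have hT : (1 + s) * (S - (lam * ε + 1)) < 2 * (m * (lam - 1)) * (1 - s * ε) := by linarith
  have hT0 : 0 ≤ (1 + s) * (S - (lam * ε + 1)) :=
    mul_nonneg (by positivity) (sub_nonneg.mpr hAS)
  have hsq := pow_lt_pow_left₀ hT hT0 two_ne_zero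
  have hlin := mul_lt_mul_of_pos_left hT (show 0 < 2 * (lam * ε + 1) * (1 + s) by positivity)
  have hkey : 0 < (4 * (m * (lam - 1)) * (1 + ε)) *
      (m * ((1 + s ^ 2 * ε) * (lam - 1)) - (1 + s) * (lam * s * ε - 1)) := by
    linear_combination hsq + hlin - (1 + s) ^ 2 * hSsq
  rw [hsδ, div_lt_iff₀ (by positivity)]
  exact sub_pos.mp (pos_of_mul_pos_right hkey (by positivity))
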